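/- There is an absolute constant a > 0 such that for every digraph G, every nonempty set of terminals T ⊆ V(G) and every positive integer c, there exists a digraph G' with T ⊆ V(G') ⊆ V(G) and |V(G')| ≤ |T| + C(|T|, ≤3c) · a^c, satisfying: (i) for every partition (A,B) of T and every X ⊆ V(G) with |X| ≤ c, X is an important A-B separator in G if and only if X ⊆ V(G') and X is an important A-B separator in G'; and (ii) G' is a (c,T) vertex cut sparsifier of G. -/

import Mathlib

/-- A digraph on vertex type `V` is given by its arc relation `E : V → V → Prop`.
`RSet E S X` is the set of vertices reachable in `G∖X` by a directed path from
some vertex of `S∖X` (every vertex of `S∖X` reaches itself). -/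
def RSet {V : Type*} (E : V → V → Prop) (S X : Finset V) : Set V :=
  {v | ∃ s ∈ S, s ∉ X ∧ Relation.ReflTransGen (fun a b => E a b ∧ b ∉ X) s v}

/-- `X` is an `A`-`B` separator: in `G∖X` no vertex of `B∖X` is reachable from `A∖X`. -/
def IsSep {V : Type*} (E : V → V → Prop) (A B X : Finset V) : Prop :=
  ∀ b ∈ B, b ∉ RSet E A X

/-- `X` is a minimal `A`-`B` separator. -/
def IsMinSep {V : Type*} [DecidableEq V] (E : V → V → Prop) (A B X : Finset V) : Prop :=
  IsSep E A B X ∧ ∀ v ∈ X, ¬ IsSep E A B (X.erase v)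

/-- `X` is an important `A`-`B` separator. -/
def IsImpSep {V : Type*} [DecidableEq V] (E : V → V → Prop) (A B X : Finset V) : Prop :=
  IsMinSep E A B X ∧
    ¬ ∃ X' : Finset V, IsSep E A B X' ∧ X'.card ≤ X.card ∧ RSet E A X ⊂ RSet E A X'

/-- `prefBinom x c = C(x, ≤c) = Σ_{i=1}^{c} binom(x, i)`. -/
def prefBinom (x c : ℕ) : ℕ := ∑ i ∈ Finset.Icc 1 c, Nat.choose x i

/-- The minimum size of an `A`-`B` separator. -/
noncomputable def minSepSize {V : Type*} (E : V → V → Prop) (A B : Finset V) : ℕ :=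
  sInf {m : ℕ | ∃ X : Finset V, IsSep E A B X ∧ X.card = m}

/-! ### Boundaries -/

section Boundary

variable {V : Type*} [Fintype V] [DecidableEq V] (E : V → V → Prop)

open Classical in
/-- The vertices outside `R` that lie in `S` or have an in-neighbour in `R`. -/
noncomputable def outBoundary (S R : Finset V) : Finset V :=
  Finset.univ.filter fun v => v ∉ R ∧ (v ∈ S ∨ ∃ u ∈ R, E u v)

variable {E}

theorem mem_outBoundary {S R : Finset V} {v : V} :
    v ∈ outBoundary E S R ↔ v ∉ R ∧ (v ∈ S ∨ ∃ u ∈ R, E u v) := by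
  simp [outBoundary]

theorem sum_outBoundary_inter_add_union_le (w : V → ℕ) (S R₁ R₂ : Finset V) :
    ∑ v ∈ outBoundary E S (R₁ ∩ R₂), w v + ∑ v ∈ outBoundary E S (R₁ ∪ R₂), w v ≤
      ∑ v ∈ outBoundary E S R₁, w v + ∑ v ∈ outBoundary E S R₂, w v := by
  have h₁ : outBoundary E S (R₁ ∩ R₂) ∪ outBoundary E S (R₁ ∪ R₂) ⊆
      outBoundary E S R₁ ∪ outBoundary E S R₂ := by
    intro v
    simp only [Finset.mem_union, mem_outBoundary, Finset.mem_inter]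
    grind
  have h₂ : outBoundary E S (R₁ ∩ R₂) ∩ outBoundary E S (R₁ ∪ R₂) ⊆
      outBoundary E S R₁ ∩ outBoundary E S R₂ := by
    intro v
    simp only [Finset.mem_union, mem_outBoundary, Finset.mem_inter]
    grind
  rw [← Finset.sum_union_inter, ← Finset.sum_union_inter (s₁ := outBoundary E S R₁)]
  exact Nat.add_le_add (Finset.sum_le_sum_of_subset h₁) (Finset.sum_le_sum_of_subset h₂)

theorem card_outBoundary_inter_add_union_le (S R₁ R₂ : Finset V) :
    (outBoundary E S (R₁ ∩ R₂)).card + (outBoundary E S (R₁ ∪ R₂)).card ≤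
      (outBoundary E S R₁).card + (outBoundary E S R₂).card := by
  simpa using sum_outBoundary_inter_add_union_le (E := E) (fun _ => 1) S R₁ R₂

/-! ### Counting important cuts -/

variable (E) in
/-- `R` avoids `B`, its boundary is inclusion-minimal among the boundaries of sets avoiding `B`,
and no superset of `R` avoiding `B` has another boundary of at most the same size. -/
structure IsImportantCut (S B R : Finset V) : Prop where
  disjoint : Disjoint R B
  minimal : ∀ R' : Finset V, Disjoint R' B → outBoundary E S R' ⊆ outBoundary E S R →
    outBoundary E S R' = outBoundary E S R
  extremal : ∀ R' : Finset V, R ⊆ R' → Disjoint R' B →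
    (outBoundary E S R').card ≤ (outBoundary E S R).card →
    outBoundary E S R' = outBoundary E S R

theorem exists_cover_importantCuts_of_bound (S B : Finset V) (k n : ℕ) :
    ∀ (P Q Z : Finset V) (l : ℕ), B ⊆ Q →
      (∀ R, P ⊆ R → Disjoint R Q → l ≤ (outBoundary E S R).card) → 2 * k ≤ n + l + Z.card →
      ∃ 𝓖 : Finset (Finset V), 𝓖.card ≤ 2 ^ n ∧
        ∀ R, IsImportantCut E S B R → P ⊆ R → Disjoint R Q → Z ⊆ outBoundary E S R →
          (outBoundary E S R).card ≤ k → outBoundary E S R ∈ 𝓖 := by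
  classical
  induction n with
  | zero =>
    intro P Q Z l _ hl hk
    refine ⟨{Z}, by simp, fun R _ hP hQ hZ hR => ?_⟩
    have h₁ := hl R hP hQ
    have h₂ := Finset.card_le_card hZ
    rw [Finset.mem_singleton]
    exact (Finset.eq_of_subset_of_card_le hZ (by omega)).symm
  | succ n ih =>
    intro P Q Z l hBQ hl hk
    by_cases hne : ∃ R, P ⊆ R ∧ Disjoint R Q
    swap
    · exact ⟨∅, by simp, fun R _ hP hQ _ _ => (hne ⟨R, hP, hQ⟩).elim⟩
    obtain ⟨M, ⟨hPM, hMQ⟩, hMmin⟩ : ∃ M, (P ⊆ M ∧ Disjoint M Q) ∧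
        ∀ R, P ⊆ R ∧ Disjoint R Q →
          (outBoundary E S M).card ≤ (outBoundary E S R).card := by
      obtain ⟨R₀, hR₀⟩ := hne
      obtain ⟨M, hM, h⟩ := Finset.exists_min_image
        (Finset.univ.filter fun R => P ⊆ R ∧ Disjoint R Q)
        (fun R => (outBoundary E S R).card) ⟨R₀, by simpa using hR₀⟩
      exact ⟨M, by simpa using hM, fun R hR => h R (by simpa using hR)⟩
    obtain ⟨N, ⟨hPN, hNQ, hNle⟩, hNmax⟩ : ∃ N, (P ⊆ N ∧ Disjoint N Q ∧
        (outBoundary E S N).card ≤ (outBoundary E S M).card) ∧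
        ∀ R, P ⊆ R ∧ Disjoint R Q ∧
          (outBoundary E S R).card ≤ (outBoundary E S M).card → R.card ≤ N.card := by
      obtain ⟨N, hN, h⟩ := Finset.exists_max_image
        (Finset.univ.filter fun R => P ⊆ R ∧ Disjoint R Q ∧
          (outBoundary E S R).card ≤ (outBoundary E S M).card)
        (fun R => R.card) ⟨M, by simp [hPM, hMQ]⟩
      exact ⟨N, by simpa using hN, fun R hR => h R (by simpa using hR)⟩
    have absorb : ∀ R, IsImportantCut E S B R → P ⊆ R → Disjoint R Q →
        IsImportantCut E S B (R ∪ N) ∧ outBoundary E S (R ∪ N) = outBoundary E S R := by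
      intro R hR hP hQ
      have hsub := card_outBoundary_inter_add_union_le (E := E) S R N
      have hinter := hMmin (R ∩ N) ⟨Finset.subset_inter hP hPN,
        hQ.mono_left Finset.inter_subset_left⟩
      have hdis : Disjoint (R ∪ N) B :=
        (Finset.disjoint_union_left.2 ⟨hQ, hNQ⟩).mono_right hBQ
      have heq := hR.extremal (R ∪ N) Finset.subset_union_left hdis (by omega)
      refine ⟨⟨hdis, ?_, ?_⟩, heq⟩
      · rw [heq]
        exact hR.minimal
      · rw [heq]
        exact fun R' h => hR.extremal R' (Finset.subset_union_left.trans h)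
    by_cases hterm : outBoundary E S N ⊆ Z
    · refine ⟨{outBoundary E S N}, by simpa using Nat.one_le_two_pow,
        fun R hR _ _ hZ _ => ?_⟩
      rw [Finset.mem_singleton]
      exact (hR.minimal N (hNQ.mono_right hBQ) (hterm.trans hZ)).symm
    obtain ⟨v, hvN, hvZ⟩ := Finset.not_subset.1 hterm
    have hvb := mem_outBoundary.1 hvN
    obtain ⟨𝓖₁, hc₁, h₁⟩ := ih N (insert v Q) (insert v Z) l
      (hBQ.trans (Finset.subset_insert _ _))
      (fun R hR hQ => hl R (hPN.trans hR) (hQ.mono_right (Finset.subset_insert _ _)))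
      (by rw [Finset.card_insert_of_notMem hvZ]; omega)
    obtain ⟨𝓖₂, hc₂, h₂⟩ := ih (insert v N) Q Z (l + 1) hBQ
      (fun R hR hQ => by
        by_contra! hlt
        have hNR : N ⊆ R := (Finset.subset_insert _ _).trans hR
        have hM := hl M hPM hMQ
        have hc := hNmax R ⟨hPN.trans hNR, hQ, by omega⟩
        have := Finset.card_le_card hR
        rw [Finset.card_insert_of_notMem hvb.1] at this
        omega)
      (by omega)
    refine ⟨𝓖₁ ∪ 𝓖₂, (Finset.card_union_le _ _).trans (by rw [pow_succ]; omega),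
      fun R hR hP hQ hZ hk' => ?_⟩
    obtain ⟨himp, heq⟩ := absorb R hR hP hQ
    have hdis : Disjoint (R ∪ N) Q := Finset.disjoint_union_left.2 ⟨hQ, hNQ⟩
    rw [← heq] at hZ hk' ⊢
    by_cases hv : v ∈ R ∪ N
    · exact Finset.mem_union_right _ (h₂ _ himp
        (Finset.insert_subset hv Finset.subset_union_right) hdis hZ hk')
    · have hvR : v ∈ outBoundary E S (R ∪ N) := by
        refine mem_outBoundary.2 ⟨hv, hvb.2.imp id ?_⟩
        rintro ⟨u, hu, huv⟩
        exact ⟨u, Finset.mem_union_right _ hu, huv⟩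
      exact Finset.mem_union_left _ (h₁ _ himp Finset.subset_union_right
        (Finset.disjoint_insert_right.2 ⟨hv, hdis⟩) (Finset.insert_subset hvR hZ) hk')

variable (E) in
theorem exists_cover_importantCuts (S B : Finset V) (k : ℕ) :
    ∃ 𝓖 : Finset (Finset V), 𝓖.card ≤ 4 ^ k ∧
      ∀ R, IsImportantCut E S B R → (outBoundary E S R).card ≤ k → outBoundary E S R ∈ 𝓖 := by
  obtain ⟨𝓖, hc, h⟩ := exists_cover_importantCuts_of_bound (E := E) S B k (2 * k) ∅ B ∅ 0
    subset_rfl (fun _ _ _ => Nat.zero_le _) (by omega)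
  exact ⟨𝓖, by rwa [pow_mul] at hc,
    fun R hR hk => h R hR (Finset.empty_subset _) hR.disjoint (Finset.empty_subset _) hk⟩

/-! ### Reducing the sink set -/

theorem exists_insert_raises_bound (w : V → ℕ) (S B B' : Finset V) (k : ℕ)
    (hB : ∀ D, Disjoint D B → k + 1 ≤ ∑ v ∈ outBoundary E S D, w v)
    (hB' : ∀ D, Disjoint D B' → k ≤ ∑ v ∈ outBoundary E S D, w v) :
    ∃ b ∈ B, ∀ D, Disjoint D (insert b B') → k + 1 ≤ ∑ v ∈ outBoundary E S D, w v := by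
  classical
  by_contra! hcon
  obtain ⟨b₀, hb₀⟩ : B.Nonempty := by
    rw [Finset.nonempty_iff_ne_empty]
    rintro rfl
    have h := hB Finset.univ (Finset.disjoint_empty_right _)
    have h0 : outBoundary E S Finset.univ = ∅ := by
      ext v
      simp [mem_outBoundary]
    simp [h0] at h
  obtain ⟨D₀, hD₀, hw₀⟩ := hcon b₀ hb₀
  obtain ⟨D, hD, hDmin⟩ := Finset.exists_min_image
    (Finset.univ.filter fun D => Disjoint D B' ∧ ∑ v ∈ outBoundary E S D, w v ≤ k)
    (fun D => D.card)
    ⟨D₀, by simpa using ⟨hD₀.mono_right (Finset.subset_insert _ _), Nat.lt_succ_iff.1 hw₀⟩⟩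
  simp only [Finset.mem_filter, Finset.mem_univ, true_and] at hD hDmin
  have hDB : Disjoint D B := by
    rw [Finset.disjoint_right]
    intro b hb hbD
    obtain ⟨D₁, hD₁, hw₁⟩ := hcon b hb
    rw [Finset.disjoint_insert_right] at hD₁
    have hsub := sum_outBoundary_inter_add_union_le (E := E) w S D D₁
    have hunion := hB' (D ∪ D₁) (Finset.disjoint_union_left.2 ⟨hD.1, hD₁.2⟩)
    have hcard := hDmin (D ∩ D₁)
      ⟨hD.1.mono_left Finset.inter_subset_left, by omega⟩
    have heq := Finset.eq_of_subset_of_card_le Finset.inter_subset_left hcard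
    rw [← heq] at hbD
    exact hD₁.1 (Finset.mem_inter.1 hbD).2
  have := hB D hDB
  omega

theorem exists_small_sink_subset_of_bound (S B : Finset V) (k : ℕ)
    (hB : ∀ D, Disjoint D B → k ≤ (outBoundary E S D).card) :
    ∃ B' ⊆ B, B'.card ≤ k ∧ ∀ D, Disjoint D B' → k ≤ (outBoundary E S D).card := by
  induction k with
  | zero => exact ⟨∅, by simp⟩
  | succ k ih =>
    obtain ⟨B', hB'B, hcard, hB'⟩ := ih fun D hD => (Nat.le_succ k).trans (hB D hD)
    obtain ⟨b, hb, h⟩ := exists_insert_raises_bound (E := E) (fun _ => 1) S B B' k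
      (by simpa using hB) (by simpa using hB')
    exact ⟨insert b B', Finset.insert_subset hb hB'B,
      (Finset.card_insert_le _ _).trans (Nat.succ_le_succ hcard), by simpa using h⟩

theorem exists_small_sink_subset (X B : Finset V)
    (hB : ∀ D, Disjoint D B → (outBoundary E X D).card ≤ X.card → outBoundary E X D = X) :
    ∃ B' ⊆ B, B'.card ≤ 2 * X.card ∧
      ∀ D, Disjoint D B' → (outBoundary E X D).card ≤ X.card → outBoundary E X D = X := by
  have hlow : ∀ D, Disjoint D B → X.card ≤ (outBoundary E X D).card := by
    intro D hD
    by_contra! hlt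
    have := hB D hD hlt.le
    rw [this] at hlt
    exact lt_irrefl _ hlt
  obtain ⟨B₀, hB₀B, hcard, hB₀⟩ := exists_small_sink_subset_of_bound X B X.card hlow
  have hsum : ∀ x (Y : Finset V), ∑ v ∈ Y, (1 + if v = x then 1 else 0) =
      Y.card + if x ∈ Y then 1 else 0 := by
    intro x Y
    simp [Finset.sum_add_distrib]
  have hext : ∀ x ∈ X, ∃ b ∈ B, ∀ D, Disjoint D (insert b B₀) →
      X.card + 1 ≤ (outBoundary E X D).card + if x ∈ outBoundary E X D then 1 else 0 := by
    intro x hx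
    have := exists_insert_raises_bound (E := E)
      (fun v => 1 + if v = x then 1 else 0) X B B₀ X.card
    simp only [hsum] at this
    refine this (fun D hD => ?_) fun D hD => (hB₀ D hD).trans (Nat.le_add_right _ _)
    rcases (hlow D hD).lt_or_eq with h | h
    · omega
    · rw [hB D hD h.ge, if_pos hx]
  choose! f hfB hf using hext
  refine ⟨B₀ ∪ X.image f, Finset.union_subset hB₀B (Finset.image_subset_iff.2 hfB), ?_, ?_⟩
  · have h₁ := Finset.card_union_le B₀ (X.image f)
    have h₂ := Finset.card_image_le (s := X) (f := f)
    omega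
  · intro D hD hle
    refine (Finset.eq_of_subset_of_card_le (fun x hx => ?_) hle).symm
    have h := hf x hx D (hD.mono_right (Finset.insert_subset
      (Finset.mem_union_right _ (Finset.mem_image_of_mem f hx)) Finset.subset_union_left))
    by_contra hxD
    rw [if_neg hxD] at h
    omega

end Boundary

/-! ### Reachable sets and separators -/

section Reach

variable {V : Type*} {E : V → V → Prop}

theorem mem_RSet_of_step {S X : Finset V} {u v : V} (hu : u ∈ RSet E S X) (huv : E u v)
    (hv : v ∉ X) : v ∈ RSet E S X := by
  obtain ⟨s, hs, hsX, h⟩ := hu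
  exact ⟨s, hs, hsX, h.tail ⟨huv, hv⟩⟩

theorem mem_RSet_of_mem {S X : Finset V} {v : V} (hv : v ∈ S) (hvX : v ∉ X) :
    v ∈ RSet E S X :=
  ⟨v, hv, hvX, .refl⟩

theorem RSet_subset_of_closed {S X : Finset V} {R : Set V}
    (hS : ∀ v ∈ S, v ∉ X → v ∈ R) (hstep : ∀ u v, u ∈ R → E u v → v ∉ X → v ∈ R) :
    RSet E S X ⊆ R := by
  rintro v ⟨s, hs, hsX, h⟩
  induction h with
  | refl => exact hS s hs hsX
  | tail _ h ih => exact hstep _ _ ih h.1 h.2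

theorem notMem_of_mem_RSet {S X : Finset V} {v : V} (hv : v ∈ RSet E S X) : v ∉ X := by
  have : RSet E S X ⊆ {v | v ∉ X} :=
    RSet_subset_of_closed (fun _ _ h => h) fun _ _ _ _ h => h
  exact this hv

theorem RSet_anti {S X Y : Finset V} (h : X ⊆ Y) : RSet E S Y ⊆ RSet E S X :=
  RSet_subset_of_closed (fun _ hv hvY => mem_RSet_of_mem hv fun hvX => hvY (h hvX))
    fun _ _ hu huv hvY => mem_RSet_of_step hu huv fun hvX => hvY (h hvX)

theorem RSet_mono_source {S S' X : Finset V} (h : S ⊆ S') : RSet E S X ⊆ RSet E S' X :=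
  RSet_subset_of_closed (fun _ hv => mem_RSet_of_mem (h hv)) fun _ _ => mem_RSet_of_step

theorem RSet_subset_RSet_of_disjoint {S X Y : Finset V} (h : ∀ v ∈ RSet E S X, v ∉ Y) :
    RSet E S X ⊆ RSet E S Y := by
  have : RSet E S X ⊆ {v | v ∈ RSet E S X ∧ v ∈ RSet E S Y} := by
    refine RSet_subset_of_closed (fun v hv hvX => ?_) fun u v hu huv hvX => ?_
    · have := mem_RSet_of_mem (E := E) hv hvX
      exact ⟨this, mem_RSet_of_mem hv (h v this)⟩
    · have := mem_RSet_of_step hu.1 huv hvX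
      exact ⟨this, mem_RSet_of_step hu.2 huv (h v this)⟩
  exact fun v hv => (this hv).2

theorem IsSep.mono {A B X Y : Finset V} (h : IsSep E A B X) (hXY : X ⊆ Y) : IsSep E A B Y :=
  fun b hb hbY => h b hb (RSet_anti hXY hbY)

theorem isSep_left (A B : Finset V) : IsSep E A B A :=
  fun _ _ ⟨_, hs, hsA, _⟩ => hsA hs

theorem minSepSize_le {A B X : Finset V} (h : IsSep E A B X) : minSepSize E A B ≤ X.card :=
  Nat.sInf_le ⟨X, h, rfl⟩

theorem exists_isSep_card_eq_minSepSize (A B : Finset V) :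
    ∃ X, IsSep E A B X ∧ X.card = minSepSize E A B :=
  Nat.sInf_mem (s := {m | ∃ X : Finset V, IsSep E A B X ∧ X.card = m})
    ⟨A.card, A, isSep_left A B, rfl⟩

theorem IsMinSep.mem_source_or_exists_in [DecidableEq V] {A B X : Finset V}
    (h : IsMinSep E A B X) {x : V} (hx : x ∈ X) : x ∈ A ∨ ∃ u ∈ RSet E A X, E u x := by
  by_contra! hcon
  refine h.2 x hx fun b hb hbR => h.1 b hb (RSet_subset_of_closed ?_ ?_ hbR)
  · intro v hv hvX
    refine mem_RSet_of_mem hv fun hvX' => hvX (Finset.mem_erase.2 ⟨?_, hvX'⟩)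
    rintro rfl
    exact hcon.1 hv
  · intro u v hu huv hvX
    refine mem_RSet_of_step hu huv fun hvX' => hvX (Finset.mem_erase.2 ⟨?_, hvX'⟩)
    rintro rfl
    exact hcon.2 u hu huv

theorem IsMinSep.eq_of_subset [DecidableEq V] {A B X Y : Finset V} (h : IsMinSep E A B X)
    (hY : IsSep E A B Y) (hYX : Y ⊆ X) : Y = X := by
  refine hYX.antisymm fun x hx => ?_
  by_contra hxY
  exact h.2 x hx (hY.mono (Finset.subset_erase.2 ⟨hYX, hxY⟩))

theorem IsSep.exists_isImpSep [Fintype V] [DecidableEq V] {A B X : Finset V}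
    (h : IsSep E A B X) :
    ∃ Y, IsImpSep E A B Y ∧ Y.card ≤ X.card ∧ RSet E A X ⊆ RSet E A Y := by
  classical
  obtain ⟨M, hM, hMmax⟩ := Finset.exists_max_image
    (Finset.univ.filter fun Y => IsSep E A B Y ∧ Y.card ≤ X.card ∧ RSet E A X ⊆ RSet E A Y)
    (fun Y => (RSet E A Y).ncard) ⟨X, by simpa using h⟩
  simp only [Finset.mem_filter, Finset.mem_univ, true_and] at hM hMmax
  obtain ⟨N, hN, hNmin⟩ := Finset.exists_min_image
    (Finset.univ.filter fun Y => IsSep E A B Y ∧ Y.card ≤ X.card ∧ RSet E A M ⊆ RSet E A Y)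
    (fun Y => Y.card) ⟨M, by simpa using ⟨hM.1, hM.2.1⟩⟩
  simp only [Finset.mem_filter, Finset.mem_univ, true_and] at hN hNmin
  refine ⟨N, ⟨⟨hN.1, fun v hv hsep => ?_⟩, ?_⟩, hN.2.1, hM.2.2.trans hN.2.2⟩
  · have := hNmin (N.erase v) ⟨hsep, (Finset.card_erase_le).trans hN.2.1,
      hN.2.2.trans (RSet_anti (Finset.erase_subset _ _))⟩
    exact absurd this (Finset.card_erase_lt_of_mem hv).not_ge
  · rintro ⟨Y, hY, hYN, hlt⟩
    have h₁ := hMmax Y ⟨hY, hYN.trans hN.2.1, hM.2.2.trans (hN.2.2.trans hlt.subset)⟩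
    have h₂ := Set.ncard_lt_ncard (hN.2.2.trans_ssubset hlt) (Set.toFinite _)
    omega

end Reach

/-! ### Important separators as important cuts -/

section Importance

variable {V : Type*} [Fintype V] {E : V → V → Prop}

variable (E) in
open Classical in
/-- The reachable set `RSet E S X` as a finset. -/
noncomputable def reachFinset (S X : Finset V) : Finset V :=
  Finset.univ.filter fun v => v ∈ RSet E S X

theorem mem_reachFinset {S X : Finset V} {v : V} :
    v ∈ reachFinset E S X ↔ v ∈ RSet E S X := by
  simp [reachFinset]

variable [DecidableEq V]

theorem outBoundary_reachFinset_subset (S X : Finset V) :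
    outBoundary E S (reachFinset E S X) ⊆ X := by
  intro v hv
  simp only [mem_outBoundary, mem_reachFinset] at hv
  by_contra hvX
  rcases hv with ⟨hvR, hvS | ⟨u, hu, huv⟩⟩
  · exact hvR (mem_RSet_of_mem hvS hvX)
  · exact hvR (mem_RSet_of_step hu huv hvX)

theorem RSet_subset_of_outBoundary_subset {S X R : Finset V} (h : outBoundary E S R ⊆ X) :
    RSet E S X ⊆ R := by
  refine RSet_subset_of_closed (fun v hv hvX => ?_) fun u v hu huv hvX => ?_
  · by_contra hvR
    exact hvX (h (mem_outBoundary.2 ⟨hvR, .inl hv⟩))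
  · by_contra hvR
    exact hvX (h (mem_outBoundary.2 ⟨hvR, .inr ⟨u, hu, huv⟩⟩))

theorem isSep_outBoundary {A B R : Finset V} (h : Disjoint R B) :
    IsSep E A B (outBoundary E A R) := fun _ hb hbR =>
  Finset.disjoint_right.1 h hb (RSet_subset_of_outBoundary_subset subset_rfl hbR)

theorem IsMinSep.outBoundary_reachFinset {A B X : Finset V} (h : IsMinSep E A B X) :
    outBoundary E A (reachFinset E A X) = X := by
  refine (outBoundary_reachFinset_subset A X).antisymm fun x hx => ?_
  simp only [mem_outBoundary, mem_reachFinset]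
  exact ⟨fun hxR => notMem_of_mem_RSet hxR hx, h.mem_source_or_exists_in hx⟩

theorem IsImpSep.outBoundary_eq {A B X R : Finset V} (h : IsImpSep E A B X)
    (hXR : RSet E A X ⊆ R) (hRB : Disjoint R B) (hcard : (outBoundary E A R).card ≤ X.card) :
    outBoundary E A R = X := by
  have hsub : RSet E A X ⊆ RSet E A (outBoundary E A R) :=
    RSet_subset_RSet_of_disjoint fun v hv hvR => (mem_outBoundary.1 hvR).1 (hXR hv)
  have heq : RSet E A X = RSet E A (outBoundary E A R) := by
    by_contra hne
    exact h.2 ⟨_, isSep_outBoundary hRB, hcard, hsub.ssubset_of_ne hne⟩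
  have hle : X ⊆ outBoundary E A R := by
    have := outBoundary_reachFinset_subset (E := E) A (outBoundary E A R)
    rwa [reachFinset, ← heq, ← reachFinset, h.1.outBoundary_reachFinset] at this
  exact (Finset.eq_of_subset_of_card_le hle hcard).symm

theorem IsImpSep.outBoundary_self_eq {A B X D : Finset V} (h : IsImpSep E A B X)
    (hD : Disjoint D B) (hcard : (outBoundary E X D).card ≤ X.card) :
    outBoundary E X D = X := by
  have hsub : outBoundary E A (reachFinset E A X ∪ D) ⊆ outBoundary E X D := by
    intro v hv
    simp only [mem_outBoundary, Finset.mem_union, not_or] at hv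
    obtain ⟨⟨hvR, hvD⟩, hv⟩ := hv
    rw [mem_outBoundary]
    refine ⟨hvD, ?_⟩
    rcases hv with hvA | ⟨u, hu | hu, huv⟩
    · exact .inl (outBoundary_reachFinset_subset A X (mem_outBoundary.2 ⟨hvR, .inl hvA⟩))
    · exact .inl (outBoundary_reachFinset_subset A X
        (mem_outBoundary.2 ⟨hvR, .inr ⟨u, hu, huv⟩⟩))
    · exact .inr ⟨u, hu, huv⟩
  have heq := h.outBoundary_eq (R := reachFinset E A X ∪ D)
    (fun v hv => Finset.mem_coe.2 (Finset.mem_union_left _ (mem_reachFinset.2 hv)))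
    (Finset.disjoint_union_left.2 ⟨Finset.disjoint_right.2 fun b hb hbR =>
      h.1.1 b hb (mem_reachFinset.1 hbR), hD⟩)
    ((Finset.card_le_card hsub).trans hcard)
  rw [heq] at hsub
  exact (Finset.eq_of_subset_of_card_le hsub hcard).symm

theorem IsMinSep.exists_small_source_subset {A B X : Finset V} (h : IsMinSep E A B X) :
    ∃ A' ⊆ A, A'.card ≤ X.card ∧ outBoundary E A' (reachFinset E A' X) = X := by
  have hex : ∀ x ∈ X, ∃ a ∈ A, ∀ A' : Finset V, a ∈ A' →
      x ∈ A' ∨ ∃ u ∈ RSet E A' X, E u x := by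
    intro x hx
    rcases h.mem_source_or_exists_in hx with hxA | ⟨u, ⟨s, hs, hsX, hsu⟩, hux⟩
    · exact ⟨x, hxA, fun _ h => .inl h⟩
    · exact ⟨s, hs, fun _ h => .inr ⟨u, ⟨s, h, hsX, hsu⟩, hux⟩⟩
  choose! f hfA hf using hex
  refine ⟨X.image f, Finset.image_subset_iff.2 hfA, Finset.card_image_le,
    (outBoundary_reachFinset_subset _ X).antisymm fun x hx => ?_⟩
  simp only [mem_outBoundary, mem_reachFinset]
  exact ⟨fun hxR => notMem_of_mem_RSet hxR hx, hf x hx _ (Finset.mem_image_of_mem f hx)⟩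

theorem IsImpSep.exists_small_importantCut {A B X : Finset V} (h : IsImpSep E A B X) :
    ∃ A' ⊆ A, ∃ B' ⊆ B, A'.card ≤ X.card ∧ B'.card ≤ 2 * X.card ∧
      ∃ R, IsImportantCut E A' B' R ∧ outBoundary E A' R = X := by
  obtain ⟨A', hA'A, hA', hX⟩ := h.1.exists_small_source_subset
  obtain ⟨B', hB'B, hB', hclose⟩ := exists_small_sink_subset X B
    fun D hD hcard => h.outBoundary_self_eq hD hcard
  have hext : ∀ R, reachFinset E A' X ⊆ R → Disjoint R B' →
      (outBoundary E A' R).card ≤ X.card → outBoundary E A' R = X := by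
    intro R hR hRB hcard
    have hsub : outBoundary E X R ⊆ outBoundary E A' R := by
      intro v hv
      rw [mem_outBoundary] at hv ⊢
      refine ⟨hv.1, ?_⟩
      rcases hv.2 with hvX | hvR
      · rw [← hX, mem_outBoundary] at hvX
        refine hvX.2.imp id ?_
        rintro ⟨u, hu, huv⟩
        exact ⟨u, hR hu, huv⟩
      · exact .inr hvR
    rw [hclose R hRB ((Finset.card_le_card hsub).trans hcard)] at hsub
    exact (Finset.eq_of_subset_of_card_le hsub hcard).symm
  refine ⟨A', hA'A, B', hB'B, hA', hB', reachFinset E A' X, ⟨?_, ?_, ?_⟩, hX⟩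
  · exact Finset.disjoint_right.2 fun b hb hbR =>
      h.1.1 b (hB'B hb) (RSet_mono_source hA'A (mem_reachFinset.1 hbR))
  · rw [hX]
    exact fun R hRB hRX => hext R
      (fun v hv => RSet_subset_of_outBoundary_subset hRX (mem_reachFinset.1 hv)) hRB
      (Finset.card_le_card hRX)
  · rw [hX]
    exact hext

end Importance

/-! ### Covering all important separators -/

theorem exists_small_cover_impSeps {V : Type*} [Fintype V] [DecidableEq V] (E : V → V → Prop)
    (T : Finset V) (c : ℕ) :
    ∃ F : Finset V, F.card ≤ prefBinom T.card (3 * c) * 64 ^ c ∧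
      ∀ A B : Finset V, A ∪ B = T → Disjoint A B → ∀ X, X.card ≤ c → IsImpSep E A B X →
        X ⊆ F := by
  choose 𝓖 h𝓖card h𝓖 using fun S B => exists_cover_importantCuts E S B c
  refine ⟨(Finset.Icc 1 (3 * c)).biUnion fun i => (T.powersetCard i).biUnion fun U =>
    U.powerset.biUnion fun A => ((𝓖 A (U \ A)).filter fun X => X.card ≤ c).biUnion id, ?_, ?_⟩
  · have hinner : ∀ A B : Finset V,
        (((𝓖 A B).filter fun X => X.card ≤ c).biUnion id).card ≤ 8 ^ c := by
      intro A B
      refine (Finset.card_biUnion_le_card_mul _ _ c fun X hX => (Finset.mem_filter.1 hX).2).trans ?_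
      calc _ ≤ 4 ^ c * 2 ^ c := Nat.mul_le_mul
            ((Finset.card_filter_le _ _).trans (h𝓖card A B)) Nat.lt_two_pow_self.le
        _ = 8 ^ c := by rw [← mul_pow]; norm_num
    refine Finset.card_biUnion_le.trans ?_
    rw [prefBinom, Finset.sum_mul]
    refine Finset.sum_le_sum fun i hi => ?_
    rw [← Finset.card_powersetCard]
    refine Finset.card_biUnion_le_card_mul _ _ _ fun U hU => ?_
    refine (Finset.card_biUnion_le_card_mul _ _ _ fun A _ => hinner A (U \ A)).trans ?_
    rw [Finset.card_powerset, (Finset.mem_powersetCard.1 hU).2]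
    calc 2 ^ i * 8 ^ c ≤ 2 ^ (3 * c) * 8 ^ c :=
          Nat.mul_le_mul_right _ (Nat.pow_le_pow_right two_pos (Finset.mem_Icc.1 hi).2)
      _ = 64 ^ c := by rw [pow_mul, ← mul_pow]; norm_num
  · intro A B hAB hdis X hXc hX x hx
    obtain ⟨A', hA'A, B', hB'B, hA', hB', R, hR, hRX⟩ := hX.exists_small_importantCut
    have hdis' : Disjoint A' B' := hdis.mono hA'A hB'B
    have hsdiff : (A' ∪ B') \ A' = B' := Finset.union_sdiff_cancel_left hdis'
    have hXmem : X ∈ 𝓖 A' ((A' ∪ B') \ A') := by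
      rw [hsdiff, ← hRX]
      exact h𝓖 A' B' R hR (by rwa [hRX])
    have hpos : 1 ≤ (A' ∪ B').card := by
      rw [Nat.one_le_iff_ne_zero, Finset.card_ne_zero]
      by_contra hempty
      rw [Finset.not_nonempty_iff_eq_empty, Finset.union_eq_empty] at hempty
      have := hR.minimal Finset.univ (by simp [hempty.2]) (by
        intro v hv
        simp [mem_outBoundary] at hv)
      rw [hRX] at this
      rw [← this] at hx
      simp [mem_outBoundary] at hx
    have hle := Finset.card_union_le A' B'
    simp only [Finset.mem_biUnion, Finset.mem_Icc, Finset.mem_powersetCard, Finset.mem_powerset,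
      Finset.mem_filter, id]
    exact ⟨_, ⟨hpos, by omega⟩, A' ∪ B',
      ⟨hAB ▸ Finset.union_subset_union hA'A hB'B, rfl⟩, A', Finset.subset_union_left,
      X, ⟨hXmem, hXc⟩, hx⟩

/-! ### The torso of a digraph -/

section Torso

variable {V : Type*} {E : V → V → Prop}

variable (E) in
/-- The arcs `x → y` with `x, y ∈ W` such that `E` has a walk from `x` to `y` all of whose inner
vertices lie outside `W`. -/
def torso (W : Finset V) (x y : V) : Prop :=
  x ∈ W ∧ y ∈ W ∧ ∃ z, Relation.ReflTransGen (fun a b => E a b ∧ b ∉ W) x z ∧ E z y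

theorem RSet_torso {W A X : Finset V} (hA : A ⊆ W) (hX : X ⊆ W) :
    RSet (torso E W) A X = RSet E A X ∩ W := by
  apply Set.Subset.antisymm
  · refine RSet_subset_of_closed (fun v hv hvX => ⟨mem_RSet_of_mem hv hvX, hA hv⟩) ?_
    rintro u v ⟨hu, -⟩ ⟨-, hvW, z, huz, hzv⟩ hvX
    refine ⟨mem_RSet_of_step ?_ hzv hvX, hvW⟩
    clear hzv
    induction huz with
    | refl => exact hu
    | tail _ h ih => exact mem_RSet_of_step ih h.1 fun hbX => h.2 (hX hbX)
  · have : RSet E A X ⊆ {u | ∃ w ∈ W, w ∈ RSet (torso E W) A X ∧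
        Relation.ReflTransGen (fun a b => E a b ∧ b ∉ W) w u ∧ (u ∈ W → w = u)} := by
      refine RSet_subset_of_closed
        (fun v hv hvX => ⟨v, hA hv, mem_RSet_of_mem hv hvX, .refl, fun _ => rfl⟩) ?_
      rintro u v ⟨w, hwW, hw, hwu, -⟩ huv hvX
      by_cases hvW : v ∈ W
      · exact ⟨v, hvW, mem_RSet_of_step hw ⟨hwW, hvW, u, hwu, huv⟩ hvX, .refl, fun _ => rfl⟩
      · exact ⟨w, hwW, hw, hwu.tail ⟨huv, hvW⟩, fun h => (hvW h).elim⟩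
    rintro v ⟨hv, hvW⟩
    obtain ⟨w, -, hw, -, heq⟩ := this hv
    exact heq hvW ▸ hw

theorem isSep_torso_iff {W A B X : Finset V} (hA : A ⊆ W) (hB : B ⊆ W) (hX : X ⊆ W) :
    IsSep (torso E W) A B X ↔ IsSep E A B X := by
  simp only [IsSep, RSet_torso hA hX]
  exact ⟨fun h b hb hbR => h b hb ⟨hbR, hB hb⟩, fun h b hb hbR => h b hb hbR.1⟩

theorem RSet_torso_inter [DecidableEq V] {W A : Finset V} (hA : A ⊆ W) (X : Finset V) :
    RSet (torso E W) A (X ∩ W) = RSet (torso E W) A X := by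
  refine Set.Subset.antisymm (RSet_subset_of_closed ?_ ?_) (RSet_anti Finset.inter_subset_left)
  · exact fun v hv hvX => mem_RSet_of_mem hv fun h => hvX (Finset.mem_inter.2 ⟨h, hA hv⟩)
  · exact fun u v hu huv hvX => mem_RSet_of_step hu huv
      fun h => hvX (Finset.mem_inter.2 ⟨h, huv.2.1⟩)

theorem IsSep.inter_of_torso [DecidableEq V] {W A B X : Finset V} (hA : A ⊆ W) (hB : B ⊆ W)
    (h : IsSep (torso E W) A B X) : IsSep E A B (X ∩ W) := by
  rw [← isSep_torso_iff hA hB Finset.inter_subset_right]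
  exact fun b hb => by simpa only [RSet_torso_inter hA] using h b hb

theorem isMinSep_torso_iff [DecidableEq V] {W A B X : Finset V} (hA : A ⊆ W) (hB : B ⊆ W)
    (hX : X ⊆ W) : IsMinSep (torso E W) A B X ↔ IsMinSep E A B X := by
  simp only [IsMinSep, isSep_torso_iff hA hB hX,
    fun v => isSep_torso_iff (E := E) hA hB ((Finset.erase_subset v X).trans hX)]

theorem isImpSep_torso_iff [Fintype V] [DecidableEq V] {W A B X : Finset V} (hA : A ⊆ W)
    (hB : B ⊆ W) (hX : X ⊆ W) (hW : ∀ Y, Y.card ≤ X.card → IsImpSep E A B Y → Y ⊆ W) :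
    IsImpSep (torso E W) A B X ↔ IsImpSep E A B X := by
  rw [IsImpSep, IsImpSep, isMinSep_torso_iff hA hB hX, and_congr_right_iff]
  refine fun hmin => not_congr ⟨?_, ?_⟩
  · rintro ⟨Y, hY, hYX, hlt⟩
    have hYW : Y ∩ W ⊆ W := Finset.inter_subset_right
    rw [← RSet_torso_inter hA Y, RSet_torso hA hX, RSet_torso hA hYW] at hlt
    refine ⟨Y ∩ W, hY.inter_of_torso hA hB,
      (Finset.card_le_card Finset.inter_subset_left).trans hYX, ?_, fun h => ?_⟩
    · exact RSet_subset_RSet_of_disjoint fun v hv hvY =>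
        notMem_of_mem_RSet (hlt.1 ⟨hv, hYW hvY⟩).1 hvY
    · exact hlt.2 (Set.inter_subset_inter_left _ h)
  · rintro ⟨Y, hY, hYX, hlt⟩
    obtain ⟨Z, hZ, hZY, hYZ⟩ := hY.exists_isImpSep
    have hZW := hW Z (hZY.trans hYX) hZ
    have hXZ := hlt.trans_subset hYZ
    refine ⟨Z, (isSep_torso_iff hA hB hZW).2 hZ.1.1, hZY.trans hYX, ?_⟩
    rw [RSet_torso hA hX, RSet_torso hA hZW]
    refine ⟨Set.inter_subset_inter_left _ hXZ.subset, fun h => ?_⟩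
    obtain ⟨x, hx, hxZ⟩ : ∃ x ∈ X, x ∉ Z := by
      by_contra! hsub
      have := Finset.eq_of_subset_of_card_le hsub (hZY.trans hYX)
      exact hXZ.ne (by rw [this])
    have hxR : x ∈ RSet E A Z := by
      rcases hmin.mem_source_or_exists_in hx with hxA | ⟨u, hu, hux⟩
      · exact mem_RSet_of_mem hxA hxZ
      · exact mem_RSet_of_step (hXZ.subset hu) hux hxZ
    exact notMem_of_mem_RSet (h ⟨hxR, hX hx⟩).1 hx

theorem minSepSize_torso [Fintype V] [DecidableEq V] {W A B : Finset V} (hA : A ⊆ W)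
    (hB : B ⊆ W) (hW : ∀ Y, Y.card ≤ minSepSize E A B → IsImpSep E A B Y → Y ⊆ W) :
    minSepSize (torso E W) A B = minSepSize E A B := by
  apply le_antisymm
  · obtain ⟨X, hX, hcard⟩ := exists_isSep_card_eq_minSepSize (E := E) A B
    obtain ⟨Y, hY, hYX, -⟩ := hX.exists_isImpSep
    rw [hcard] at hYX
    exact (minSepSize_le ((isSep_torso_iff hA hB (hW Y hYX hY)).2 hY.1.1)).trans hYX
  · obtain ⟨X, hX, hcard⟩ := exists_isSep_card_eq_minSepSize (E := torso E W) A B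
    rw [← hcard]
    exact (minSepSize_le (hX.inter_of_torso hA hB)).trans
      (Finset.card_le_card Finset.inter_subset_left)

end Torso

/-- there is an absolute constant `a > 0` such that every digraph admits,
for every nonempty terminal set `T` and every `c ≥ 1`, a vertex sparsifier `G'` with
`T ⊆ V(G') ⊆ V(G)` of size at most `|T| + C(|T|,≤3c)·a^c` which preserves all important
`A`-`B` separators of size `≤ c` for all partitions `(A,B)` of `T`, and which is a
`(c,T)` vertex cut sparsifier of `G`. -/
theorem deterministic_vertex_cut_sparsifier :
    ∃ a : ℝ, 0 < a ∧
      ∀ (V : Type) [Fintype V] [DecidableEq V] (E : V → V → Prop)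
        (T : Finset V) (c : ℕ), T.Nonempty → 0 < c →
        ∃ (W : Finset V) (E' : V → V → Prop),
          T ⊆ W ∧ (∀ x y : V, E' x y → x ∈ W ∧ y ∈ W) ∧
          (W.card : ℝ) ≤ (T.card : ℝ) + (prefBinom T.card (3 * c) : ℝ) * a ^ c ∧
          (∀ A B : Finset V, A ∪ B = T → Disjoint A B →
            ∀ X : Finset V, X.card ≤ c →
              (IsImpSep E A B X ↔ X ⊆ W ∧ IsImpSep E' A B X)) ∧
          (∀ A B : Finset V, A ∪ B = T → Disjoint A B →
            minSepSize E A B ≤ c → minSepSize E' A B = minSepSize E A B) := by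
  refine ⟨64, by norm_num, fun V _ _ E T c _ _ => ?_⟩
  obtain ⟨F, hFcard, hF⟩ := exists_small_cover_impSeps E T c
  have hA : ∀ {A B : Finset V}, A ∪ B = T → A ⊆ T ∪ F := fun h =>
    (Finset.subset_union_left.trans h.subset).trans Finset.subset_union_left
  have hB : ∀ {A B : Finset V}, A ∪ B = T → B ⊆ T ∪ F := fun h =>
    (Finset.subset_union_right.trans h.subset).trans Finset.subset_union_left
  have hX : ∀ {A B : Finset V}, A ∪ B = T → Disjoint A B → ∀ X, X.card ≤ c →
      IsImpSep E A B X → X ⊆ T ∪ F := fun hAB hdis X hXc hX =>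
    (hF _ _ hAB hdis X hXc hX).trans Finset.subset_union_right
  refine ⟨T ∪ F, torso E (T ∪ F), Finset.subset_union_left, fun x y h => ⟨h.1, h.2.1⟩, ?_, ?_, ?_⟩
  · exact_mod_cast (Finset.card_union_le T F).trans (Nat.add_le_add_left hFcard _)
  · intro A B hAB hdis X hXc
    constructor
    · intro h
      have hXW := hX hAB hdis X hXc h
      exact ⟨hXW, (isImpSep_torso_iff (hA hAB) (hB hAB) hXW
        fun Y hY => hX hAB hdis Y (hY.trans hXc)).2 h⟩
    · rintro ⟨hXW, h⟩
      exact (isImpSep_torso_iff (hA hAB) (hB hAB) hXW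
        fun Y hY => hX hAB hdis Y (hY.trans hXc)).1 h
  · intro A B hAB hdis hc
    exact minSepSize_torso (hA hAB) (hB hAB) fun Y hY => hX hAB hdis Y (hY.trans hc)
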